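/- Let F be a finite field and n ≥ 1. Every invertible n×n matrix M over F can be written as a product of at most ⌊3n/2⌋ bijective linear instructions, i.e. invertible matrices over F each of which differs from the n×n identity matrix in at most one row. -/

import Mathlib

/-- A linear instruction: an `n × n` matrix over `F` that differs from the identity
matrix in at most one row. -/
def Matrix.IsLinearInstruction {F : Type*} [Semiring F] {n : ℕ}
    (M : Matrix (Fin n) (Fin n) F) : Prop :=
  ∃ i : Fin n, ∀ j : Fin n, j ≠ i → M j = (1 : Matrix (Fin n) (Fin n) F) j

namespace Matrix

variable {F : Type*} [Field F] {n : ℕ}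

theorem mul_updateRow_one_apply (M : Matrix (Fin n) (Fin n) F) (i : Fin n) (w : Fin n → F)
    (a b : Fin n) :
    (M * updateRow 1 i w) a b = M a b + M a i * (w b - (1 : Matrix (Fin n) (Fin n) F) i b) := by
  have h : updateRow (1 : Matrix (Fin n) (Fin n) F) i w =
      1 + vecMulVec (Pi.single i 1) (w - (1 : Matrix (Fin n) (Fin n) F) i) := by
    ext c d
    by_cases hc : c = i
    · subst hc
      simp [vecMulVec_apply]
    · simp [vecMulVec_apply, hc]
  rw [h, mul_add, mul_one, mul_vecMulVec]
  simp [vecMulVec_apply]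

theorem isUnit_updateRow_one {i : Fin n} {w : Fin n → F} (hw : w i ≠ 0) :
    IsUnit (updateRow (1 : Matrix (Fin n) (Fin n) F) i w) := by
  refine IsUnit.of_mul_eq_one
    (updateRow 1 i fun b => (1 : Matrix (Fin n) (Fin n) F) i b * (1 + (w i)⁻¹) - (w i)⁻¹ * w b) ?_
  ext a b
  rw [mul_updateRow_one_apply]
  by_cases ha : a = i
  · subst ha
    simp only [updateRow_self]
    field_simp
    ring
  · simp [updateRow_ne ha, one_apply_ne ha]

theorem isLinearInstruction_updateRow_one (i : Fin n) (w : Fin n → F) :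
    (updateRow (1 : Matrix (Fin n) (Fin n) F) i w).IsLinearInstruction :=
  ⟨i, fun _ hj => updateRow_ne hj⟩

theorem IsLinearInstruction.inv {A : Matrix (Fin n) (Fin n) F} (hA : A.IsLinearInstruction)
    (hu : IsUnit A) : A⁻¹.IsLinearInstruction := by
  obtain ⟨i, hi⟩ := hA
  refine ⟨i, fun j hj => ?_⟩
  have h := congrFun (mul_nonsing_inv A ((isUnit_iff_isUnit_det A).1 hu)) j
  rwa [mul_apply_eq_vecMul, hi j hj, ← mul_apply_eq_vecMul, one_mul] at h

/-- If `M i i ≠ 0`, one instruction makes the `i`-th row of `M` trivial; the diagonal of the result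
is given by the principal `2 × 2` minors of `M` containing `i`. -/
theorem exists_eq_mul_of_diag_ne_zero {M : Matrix (Fin n) (Fin n) F} (hM : IsUnit M)
    {S : Finset (Fin n)} (hS : ∀ a ∉ S, M a = (1 : Matrix (Fin n) (Fin n) F) a)
    {i : Fin n} (hi : M i i ≠ 0) :
    ∃ N A : Matrix (Fin n) (Fin n) F, M = N * A ∧ IsUnit N ∧ IsUnit A ∧ A.IsLinearInstruction ∧
      (∀ a ∉ S.erase i, N a = (1 : Matrix (Fin n) (Fin n) F) a) ∧
      ∀ j ≠ i, M i i * N j j = M i i * M j j - M j i * M i j := by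
  set A := updateRow (1 : Matrix (Fin n) (Fin n) F) i (M i) with hAdef
  have hA : IsUnit A := isUnit_updateRow_one hi
  have hAA : A * A⁻¹ = 1 := mul_nonsing_inv A ((isUnit_iff_isUnit_det A).1 hA)
  have hNA : M * A⁻¹ * A = M := by
    rw [mul_assoc, nonsing_inv_mul A ((isUnit_iff_isUnit_det A).1 hA), mul_one]
  refine ⟨M * A⁻¹, A, hNA.symm, ?_, hA, isLinearInstruction_updateRow_one i _, ?_, ?_⟩
  · exact hM.mul (IsUnit.of_mul_eq_one_right A hAA)
  · intro a ha
    have h : M a = A a := by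
      by_cases hai : a = i
      · subst hai
        simp [hAdef]
      · rw [hS a fun h => ha (Finset.mem_erase.2 ⟨hai, h⟩), hAdef, updateRow_ne hai]
    rw [mul_apply_eq_vecMul, h, ← mul_apply_eq_vecMul, hAA]
  · intro j hj
    generalize M * A⁻¹ = N at hNA
    have h1 := mul_updateRow_one_apply N i (M i) j j
    have h2 := mul_updateRow_one_apply N i (M i) j i
    rw [← hAdef, hNA] at h1 h2
    rw [one_apply_ne hj.symm] at h1
    rw [one_apply_eq] at h2
    rw [h1, h2]
    ring

/-- In an invertible matrix that is trivial outside the rows in `S` and has zero diagonal on `S`,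
each column in `S` has an off-diagonal nonzero entry in `S`. -/
theorem exists_mem_ne_apply_ne_zero {M : Matrix (Fin n) (Fin n) F} (hM : IsUnit M)
    {S : Finset (Fin n)} (hS : ∀ a ∉ S, M a = (1 : Matrix (Fin n) (Fin n) F) a)
    (hd : ∀ a ∈ S, M a a = 0) {i : Fin n} (hi : i ∈ S) :
    ∃ k ∈ S, k ≠ i ∧ M k i ≠ 0 := by
  by_contra! h
  refine ((isUnit_iff_isUnit_det M).1 hM).ne_zero (det_eq_zero_of_column_eq_zero i fun k => ?_)
  by_cases hki : k = i
  · exact hki ▸ hd i hi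
  by_cases hk : k ∈ S
  · exact h k hk hki
  · rw [hS k hk, one_apply_ne hki]

/-- If `M` has zero diagonal on `S`, one instruction makes two successive diagonal pivots
available. -/
theorem exists_eq_mul_of_diag_eq_zero {M : Matrix (Fin n) (Fin n) F} (hM : IsUnit M)
    {S : Finset (Fin n)} (hS : ∀ a ∉ S, M a = (1 : Matrix (Fin n) (Fin n) F) a)
    (hd : ∀ a ∈ S, M a a = 0) (hne : S.Nonempty) :
    ∃ N A : Matrix (Fin n) (Fin n) F, M = N * A ∧ IsUnit N ∧ IsUnit A ∧ A.IsLinearInstruction ∧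
      (∀ a ∉ S, N a = (1 : Matrix (Fin n) (Fin n) F) a) ∧
      ∃ k ∈ S, ∃ j ∈ S, j ≠ k ∧ N k k ≠ 0 ∧ N k k * N j j - N j k * N k j ≠ 0 := by
  obtain ⟨i, hi⟩ := hne
  obtain ⟨k, hk, hki, hMki⟩ := exists_mem_ne_apply_ne_zero hM hS hd hi
  obtain ⟨j, hj, hjk, hMjk⟩ := exists_mem_ne_apply_ne_zero hM hS hd hk
  obtain ⟨w, hwi, hwk, hw⟩ : ∃ w : Fin n → F, w i = 1 ∧ w k = 1 ∧
      (j ≠ i → w j = -(1 + M j k * M k j + M j i * M k j) / (M j k * M k i)) := by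
    refine ⟨fun b => if b = i ∨ b = k then 1 else
      -(1 + M j k * M k j + M j i * M k j) / (M j k * M k i), by simp, by simp, fun h => ?_⟩
    simp [h, hjk]
  have hA : IsUnit (updateRow (1 : Matrix (Fin n) (Fin n) F) i w) :=
    isUnit_updateRow_one (by simp [hwi])
  have hdet := (isUnit_iff_isUnit_det _).1 hA
  refine ⟨M * updateRow 1 i w, (updateRow 1 i w)⁻¹, ?_, hM.mul hA, ?_,
    (isLinearInstruction_updateRow_one i w).inv hA, ?_, k, hk, j, hj, hjk, ?_, ?_⟩
  · rw [mul_assoc, mul_nonsing_inv _ hdet, mul_one]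
  · exact IsUnit.of_mul_eq_one _ (nonsing_inv_mul _ hdet)
  · intro a ha
    have hai : a ≠ i := fun h => ha (h ▸ hi)
    ext b
    rw [mul_updateRow_one_apply, hS a ha, one_apply_ne hai, zero_mul, add_zero]
  · rw [mul_updateRow_one_apply, hd k hk, hwk, one_apply_ne hki.symm]
    simpa using hMki
  · simp only [mul_updateRow_one_apply, hd k hk, hd j hj, hwk, one_apply_ne hki.symm]
    by_cases hji : j = i
    · subst hji
      simp [hwi, hd j hj, hMki, hMjk]
    · rw [hw hji, one_apply_ne (Ne.symm hji)]
      have h1 : ∀ x : F, x = 1 → x ≠ 0 := fun x hx => hx ▸ one_ne_zero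
      apply h1
      field_simp
      ring

theorem exists_list_prod_eq_of_rows_eq_one (S : Finset (Fin n)) (M : Matrix (Fin n) (Fin n) F)
    (hM : IsUnit M) (hS : ∀ a ∉ S, M a = (1 : Matrix (Fin n) (Fin n) F) a) :
    ∃ L : List (Matrix (Fin n) (Fin n) F),
      L.length ≤ 3 * S.card / 2 ∧ (∀ A ∈ L, IsUnit A ∧ A.IsLinearInstruction) ∧ L.prod = M := by
  induction hc : S.card using Nat.strong_induction_on generalizing S M with
  | _ c ih =>
  subst hc
  by_cases hd : ∀ a ∈ S, M a a = 0
  · rcases S.eq_empty_or_nonempty with rfl | hne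
    · exact ⟨[], by simp, by simp, by ext a : 1; simp [hS a]⟩
    obtain ⟨N, A, rfl, hN, hA, hA', hNS, k, hk, j, hj, hjk, hkk, hminor⟩ :=
      exists_eq_mul_of_diag_eq_zero hM hS hd hne
    obtain ⟨P, B, rfl, hP, hB, hB', hPS, hPd⟩ := exists_eq_mul_of_diag_ne_zero hN hNS hkk
    have hjj : P j j ≠ 0 := fun h => hminor (by rw [← hPd j hjk, h, mul_zero])
    obtain ⟨Q, C, rfl, hQ, hC, hC', hQS, -⟩ := exists_eq_mul_of_diag_ne_zero hP hPS hjj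
    have h1 := Finset.card_erase_add_one hk
    have h2 := Finset.card_erase_add_one (Finset.mem_erase.2 ⟨hjk, hj⟩)
    obtain ⟨L, hL, hL', rfl⟩ := ih _ (by omega) _ Q hQ hQS rfl
    refine ⟨L ++ [C, B, A], ?_, ?_, by simp [mul_assoc]⟩
    · simp only [List.length_append, List.length_cons, List.length_nil]
      omega
    · intro D hD
      simp only [List.mem_append, List.mem_cons, List.not_mem_nil, or_false] at hD
      rcases hD with hD | rfl | rfl | rfl
      exacts [hL' D hD, ⟨hC, hC'⟩, ⟨hB, hB'⟩, ⟨hA, hA'⟩]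
  · push Not at hd
    obtain ⟨i, hi, hii⟩ := hd
    obtain ⟨N, A, rfl, hN, hA, hA', hNS, -⟩ := exists_eq_mul_of_diag_ne_zero hM hS hii
    have h1 := Finset.card_erase_add_one hi
    obtain ⟨L, hL, hL', rfl⟩ := ih _ (by omega) _ N hN hNS rfl
    refine ⟨L ++ [A], ?_, ?_, by simp⟩
    · simp only [List.length_append, List.length_cons, List.length_nil]
      omega
    · intro D hD
      simp only [List.mem_append, List.mem_cons, List.not_mem_nil, or_false] at hD
      rcases hD with hD | rfl
      exacts [hL' D hD, ⟨hA, hA'⟩]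

end Matrix


/-- Every invertible `n × n` matrix over a finite field `F` is a product of at most
`⌊3n/2⌋` bijective (invertible) linear instructions. -/
theorem every_invertible_matrix_is_product_of_bijective_instructions
    (F : Type*) [Field F] [Fintype F] (n : ℕ) (hn : 1 ≤ n)
    (M : Matrix (Fin n) (Fin n) F) (hM : IsUnit M) :
    ∃ L : List (Matrix (Fin n) (Fin n) F),
      L.length ≤ 3 * n / 2 ∧
      (∀ A ∈ L, IsUnit A ∧ A.IsLinearInstruction) ∧
      L.prod = M := by
  simpa using Matrix.exists_list_prod_eq_of_rows_eq_one Finset.univ M hM (by simp)
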